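/- Let (U_i, 𝔅_i), i = 1,…,N, be measurable spaces whose σ-algebras contain all singletons, and let A, B : U = U_1 × ⋯ × U_N → ℝ be measurable functions such that A and B are integrable with respect to every product μ_1 × ⋯ × μ_N of probability measures μ_i on U_i and B is strictly of constant sign on U. If the test function C(u) = A(u)/B(u) is bounded below on U but does not attain its infimum, then for every ε > 0 there exists a point u(ε) = (u_1(ε),…,u_N(ε)) ∈ U with −∞ < inf_{u ∈ U} C(u) < C(u(ε)) < inf_{u ∈ U} C(u) + ε, and the family of degenerate (Dirac) measures (δ_{u_1(ε)},…,δ_{u_N(ε)}) is ε-optimal: inf_{u ∈ U} C(u) < I(δ_{u_1(ε)},…,δ_{u_N(ε)}) < inf_{u ∈ U} C(u) + ε, while I(μ_1,…,μ_N) > inf_{u ∈ U} C(u) for every family (μ_1,…,μ_N) of probability measures. -/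

import Mathlib

open MeasureTheory

theorem integral_pos_of_forall_pos {X : Type*} [MeasurableSpace X] {P : Measure X} [NeZero P]
    {f : X → ℝ} (hf : Integrable f P) (hpos : ∀ x, 0 < f x) : 0 < ∫ x, f x ∂P := by
  rw [integral_pos_iff_support_of_nonneg (fun x => (hpos x).le) hf]
  have hsupp : Function.support f = Set.univ := Set.eq_univ_of_forall fun x => (hpos x).ne'
  rw [hsupp]
  exact Measure.measure_univ_pos.2 (NeZero.ne P)

theorem lt_integral_div_integral_of_pos {X : Type*} [MeasurableSpace X] {P : Measure X} [NeZero P]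
    {A B : X → ℝ} (hA : Integrable A P) (hB : Integrable B P) (hpos : ∀ x, 0 < B x) {m : ℝ}
    (hm : ∀ x, m < A x / B x) : m < (∫ x, A x ∂P) / ∫ x, B x ∂P := by
  rw [lt_div_iff₀ (integral_pos_of_forall_pos hB hpos), ← sub_pos, ← integral_const_mul,
    ← integral_sub hA (hB.const_mul m)]
  exact integral_pos_of_forall_pos (hA.sub (hB.const_mul m))
    fun x => sub_pos.2 ((lt_div_iff₀ (hpos x)).1 (hm x))

/-- A strict lower bound of `A / B` is a strict lower bound of the ratio of the integrals,
provided `B` has constant sign. -/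
theorem lt_integral_div_integral {X : Type*} [MeasurableSpace X] {P : Measure X} [NeZero P]
    {A B : X → ℝ} (hA : Integrable A P) (hB : Integrable B P)
    (hsign : (∀ x, 0 < B x) ∨ (∀ x, B x < 0)) {m : ℝ} (hm : ∀ x, m < A x / B x) :
    m < (∫ x, A x ∂P) / ∫ x, B x ∂P := by
  rcases hsign with hpos | hneg
  · exact lt_integral_div_integral_of_pos hA hB hpos hm
  · have h := lt_integral_div_integral_of_pos (A := fun x => -A x) (B := fun x => -B x)
      hA.neg hB.neg (fun x => neg_pos.2 (hneg x)) (m := m)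
      (fun x => by rw [neg_div_neg_eq]; exact hm x)
    rwa [integral_neg, integral_neg, neg_div_neg_eq] at h

theorem pi_dirac_eq_dirac {ι : Type*} [Fintype ι] {U : ι → Type*} [∀ i, MeasurableSpace (U i)]
    (u : ∀ i, U i) : (Measure.pi fun i => Measure.dirac (u i)) = Measure.dirac u := by
  classical
  refine Measure.pi_eq fun s hs => ?_
  rw [Measure.dirac_apply' u (MeasurableSet.univ_pi hs)]
  simp only [Measure.dirac_apply' _ (hs _), Set.indicator_apply, Set.mem_univ_pi, Pi.one_apply,
    Finset.prod_ite_zero, Finset.mem_univ, true_imp_iff, Finset.prod_const_one]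

/-- If the test function `C = A/B` is bounded below on `U` but does not attain its infimum,
then for every `ε > 0` there is a point `u(ε) ∈ U` whose test-function value lies within `ε`
of the infimum, the corresponding family of Dirac measures is `ε`-optimal for the
linear-fractional integral functional, and every family of probability measures gives a value
strictly above the infimum. -/
theorem stmt_8 {N : ℕ} {U : Fin N → Type*} [∀ i, MeasurableSpace (U i)]
    [∀ i, MeasurableSingletonClass (U i)] [∀ i, Nonempty (U i)]
    (A B : ((i : Fin N) → U i) → ℝ)
    (hAm : Measurable A) (hBm : Measurable B)
    (hA : ∀ μ : ∀ i, Measure (U i), (∀ i, IsProbabilityMeasure (μ i)) →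
      Integrable A (Measure.pi μ))
    (hB : ∀ μ : ∀ i, Measure (U i), (∀ i, IsProbabilityMeasure (μ i)) →
      Integrable B (Measure.pi μ))
    (hBsign : (∀ u, 0 < B u) ∨ (∀ u, B u < 0))
    (hbdd : BddBelow (Set.range fun u => A u / B u))
    (hnotattain : ∀ u, (⨅ v, A v / B v) < A u / B u) :
    (∀ ε > (0 : ℝ), ∃ u : (i : Fin N) → U i,
      ((⨅ v, A v / B v) < A u / B u ∧ A u / B u < (⨅ v, A v / B v) + ε) ∧
      ((⨅ v, A v / B v) <
          (∫ v, A v ∂Measure.pi fun i => Measure.dirac (u i)) /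
            (∫ v, B v ∂Measure.pi fun i => Measure.dirac (u i)) ∧
        (∫ v, A v ∂Measure.pi fun i => Measure.dirac (u i)) /
            (∫ v, B v ∂Measure.pi fun i => Measure.dirac (u i)) < (⨅ v, A v / B v) + ε)) ∧
    (∀ μ : ∀ i, Measure (U i), (∀ i, IsProbabilityMeasure (μ i)) →
      (⨅ v, A v / B v) < (∫ u, A u ∂Measure.pi μ) / (∫ u, B u ∂Measure.pi μ)) := by
  refine ⟨fun ε hε => ?_, fun μ hμ => ?_⟩
  · obtain ⟨u, hu⟩ := exists_lt_of_ciInf_lt (lt_add_of_pos_right (⨅ v, A v / B v) hε)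
    refine ⟨u, ⟨hnotattain u, hu⟩, ?_⟩
    rw [pi_dirac_eq_dirac, integral_dirac' A u hAm.stronglyMeasurable,
      integral_dirac' B u hBm.stronglyMeasurable]
    exact ⟨hnotattain u, hu⟩
  · exact lt_integral_div_integral (hA μ hμ) (hB μ hμ) hBsign hnotattain
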